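/- arXiv:2303.14634 — 2 statements merged into one kernel-verified Lean document; each statement's English description precedes it below -/
import Mathlib

section
/- (Proposition 1, deterministic sample-path version) Suppose e : Fin N → ℝ satisfies e_i ≥ 0 for all i, and (W^c, W^L + e, u) is an optimal solution of problem (7). Then (W^c + Σ_i e_i, W^L, v) is also an optimal solution of problem (7), where v is the scheduler defined by v_i(t) = 1 if (u_i(t) = 1 and W_i(t) > W_i^L + e_i) or W_i^L ≤ W_i(t) ≤ W_i^L + e_i, and v_i(t) = 0 otherwise. -/
open Filter Finset

noncomputable section

/-- `{0,1}`-valued real indicator of a proposition. -/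
def ind (P : Prop) [Decidable P] : ℝ := if P then 1 else 0

/-- Positive part `[x]^+ = max(x,0)`. -/
def pos (x : ℝ) : ℝ := max x 0

/-- A scheduler takes values in `{0,1}`. -/
def IsScheduler {N : ℕ} (u : ℕ → Fin N → ℝ) : Prop :=
  ∀ t i, u t i = 0 ∨ u t i = 1

/-- Feasibility of the triple `(Wc, Wr, u)` for problem (7). -/
def Feasible7 {N : ℕ} (W : ℕ → Fin N → ℝ) (PH : Fin N → ℝ) (F : Fin N → ℝ → ℝ)
    (WL : Fin N → ℝ) (Wc : ℝ) (Wr : Fin N → ℝ) (u : ℕ → Fin N → ℝ) : Prop :=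
  (∀ i, PH i - F i (Wr i) ≤
      Filter.liminf (fun T : ℕ =>
        (1 / (T : ℝ)) * ∑ t ∈ Finset.Icc 1 T, u t i * ind (Wr i < W t i)) Filter.atTop) ∧
  (∀ i, WL i ≤ Wr i) ∧
  (∀ t, ∑ i, u t i * pos (W t i - Wr i) ≤ Wc + ∑ i, pos (Wr i - W t i)) ∧
  IsScheduler u

/-- Objective value of problem (7). -/
def objective7 {N : ℕ} (Wc : ℝ) (Wr : Fin N → ℝ) : ℝ := Wc + ∑ i, Wr i

/-- Optimality of the triple `(Wc, Wr, u)` for problem (7). -/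
def Optimal7 {N : ℕ} (W : ℕ → Fin N → ℝ) (PH : Fin N → ℝ) (F : Fin N → ℝ → ℝ)
    (WL : Fin N → ℝ) (Wc : ℝ) (Wr : Fin N → ℝ) (u : ℕ → Fin N → ℝ) : Prop :=
  Feasible7 W PH F WL Wc Wr u ∧
  ∀ (Wc' : ℝ) (Wr' : Fin N → ℝ) (u' : ℕ → Fin N → ℝ),
    Feasible7 W PH F WL Wc' Wr' u' → objective7 Wc Wr ≤ objective7 Wc' Wr'

/-- Feasibility of the pair `(Wc, u)` for problem (10), where `P^M_i = F_i(W_i^L)`. -/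
def Feasible10 {N : ℕ} (W : ℕ → Fin N → ℝ) (PH : Fin N → ℝ) (F : Fin N → ℝ → ℝ)
    (WL : Fin N → ℝ) (Wc : ℝ) (u : ℕ → Fin N → ℝ) : Prop :=
  (∀ i, PH i - F i (WL i) ≤
      Filter.liminf (fun T : ℕ =>
        (1 / (T : ℝ)) * ∑ t ∈ Finset.Icc 1 T, u t i * ind (WL i < W t i)) Filter.atTop) ∧
  (∀ t, ∑ i, u t i * pos (W t i - WL i) ≤ Wc + ∑ i, pos (WL i - W t i)) ∧
  IsScheduler u

/-- Optimality of the pair `(Wc, u)` for problem (10); the objective is `Wc`. -/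
def Optimal10 {N : ℕ} (W : ℕ → Fin N → ℝ) (PH : Fin N → ℝ) (F : Fin N → ℝ → ℝ)
    (WL : Fin N → ℝ) (Wc : ℝ) (u : ℕ → Fin N → ℝ) : Prop :=
  Feasible10 W PH F WL Wc u ∧
  ∀ (Wc' : ℝ) (u' : ℕ → Fin N → ℝ), Feasible10 W PH F WL Wc' u' → Wc ≤ Wc'

/-- Averages of a `[0,1]`-valued sequence lie in `[0,1]`. -/
lemma average_mem_Icc {a : ℕ → ℝ} (ha : ∀ t, a t ∈ Set.Icc (0 : ℝ) 1) (T : ℕ) :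
    (1 / (T : ℝ)) * ∑ t ∈ Finset.Icc 1 T, a t ∈ Set.Icc (0 : ℝ) 1 := by
  have h0 : 0 ≤ ∑ t ∈ Finset.Icc 1 T, a t := Finset.sum_nonneg fun t _ => (ha t).1
  have h1 : ∑ t ∈ Finset.Icc 1 T, a t ≤ T := by
    simpa using Finset.sum_le_card_nsmul (Finset.Icc 1 T) a 1 fun t _ => (ha t).2
  refine ⟨by positivity, ?_⟩
  rw [one_div_mul_eq_div]
  exact div_le_one_of_le₀ h1 (by positivity)

/-- Adding a convergent sequence to a bounded one shifts a lower bound on the lower limit. -/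
lemma le_liminf_add_of_tendsto {a b : ℕ → ℝ} {c l : ℝ} (ha : ∀ n, a n ∈ Set.Icc (0 : ℝ) 1)
    (hb : Tendsto b atTop (nhds l)) (hc : c ≤ liminf a atTop) :
    c + l ≤ liminf (fun n => a n + b n) atTop := by
  have ha_ge : IsBoundedUnder (· ≥ ·) atTop a := isBoundedUnder_of ⟨0, fun n => (ha n).1⟩
  have ha_le : IsBoundedUnder (· ≤ ·) atTop a := isBoundedUnder_of ⟨1, fun n => (ha n).2⟩
  calc c + l ≤ liminf a atTop + liminf b atTop := by rw [hb.liminf_eq]; gcongr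
    _ ≤ liminf (a + b) atTop := le_liminf_add ha_ge ha_le
        hb.isBoundedUnder_ge hb.isBoundedUnder_le.isCoboundedUnder_ge

/-- The modified scheduler serves a burst above `l` exactly when the original one serves a burst
above `l + e`, or when the demand lies in `(l, l + e]`. -/
lemma ind_mul_ind_lt {l e w x : ℝ} (he : 0 ≤ e) (hx : x = 0 ∨ x = 1) :
    ind ((x = 1 ∧ l + e < w) ∨ (l ≤ w ∧ w ≤ l + e)) * ind (l < w) =
      x * ind (l + e < w) + (ind (w ≤ l + e) - ind (w ≤ l)) := by
  unfold ind
  rcases hx with rfl | rfl <;> grind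

/-- Per-user comparison of the capacity constraints of the two schedulers. -/
lemma ind_mul_pos_add_pos_le {l e w x : ℝ} (he : 0 ≤ e) (hx : x = 0 ∨ x = 1) :
    ind ((x = 1 ∧ l + e < w) ∨ (l ≤ w ∧ w ≤ l + e)) * pos (w - l) + pos (l + e - w) ≤
      x * pos (w - (l + e)) + e + pos (l - w) := by
  unfold ind pos
  rcases hx with rfl | rfl <;> split_ifs <;> grind

/-- Proposition 1 (deterministic sample-path version). -/
theorem proposition1 {N : ℕ} (W : ℕ → Fin N → ℝ) (PH PL : Fin N → ℝ) (F : Fin N → ℝ → ℝ)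
    (hF : ∀ i x, Filter.Tendsto
      (fun T : ℕ => (1 / (T : ℝ)) * ∑ t ∈ Finset.Icc 1 T, ind (W t i ≤ x))
      Filter.atTop (nhds (F i x)))
    (WL : Fin N → ℝ) (hWL : ∀ i, PL i ≤ F i (WL i))
    (e : Fin N → ℝ) (he : ∀ i, 0 ≤ e i)
    (Wc : ℝ) (u : ℕ → Fin N → ℝ)
    (hopt : Optimal7 W PH F WL Wc (fun i => WL i + e i) u) :
    Optimal7 W PH F WL (Wc + ∑ i, e i) WL
      (fun t i => ind ((u t i = 1 ∧ WL i + e i < W t i) ∨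
        (WL i ≤ W t i ∧ W t i ≤ WL i + e i))) := by
  obtain ⟨⟨hserve, -, hcap, hu⟩, hmin⟩ := hopt
  refine ⟨⟨fun i => ?_, fun i => le_rfl, fun t => ?_, fun t i => ?_⟩, fun Wc' Wr' u' h => ?_⟩
  · have hmem : ∀ t, u t i * ind (WL i + e i < W t i) ∈ Set.Icc (0 : ℝ) 1 := fun t => by
      unfold ind
      rcases hu t i with h | h <;> rw [h] <;> split_ifs <;> norm_num
    have hlim := le_liminf_add_of_tendsto (average_mem_Icc hmem)
      ((hF i (WL i + e i)).sub (hF i (WL i))) (hserve i)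
    simp only [ind_mul_ind_lt (he i) (hu _ i), Finset.sum_add_distrib, Finset.sum_sub_distrib,
      mul_add, mul_sub]
    linarith
  · have hsum := Finset.sum_le_sum fun i (_ : i ∈ Finset.univ) =>
      ind_mul_pos_add_pos_le (l := WL i) (w := W t i) (he i) (hu t i)
    simp only [Finset.sum_add_distrib] at hsum
    have := hcap t
    linarith
  · simp only [ind]
    split_ifs <;> simp
  · have := hmin Wc' Wr' u' h
    simp only [objective7, Finset.sum_add_distrib] at this ⊢
    linarith
end
end

section
/- (Capacity-constraint transfer, (premise) implies (target) in the proof of Proposition 1) Let N ∈ ℕ, and let w, L, e : Fin N → ℝ with e_i ≥ 0 for all i, let u : Fin N → ℝ take values in {0,1}, and let W^c ∈ ℝ. Define v : Fin N → ℝ by v_i = 1 if (u_i = 1 and w_i > L_i + e_i) or L_i ≤ w_i ≤ L_i + e_i, and v_i = 0 otherwise. If Σ_i u_i·[w_i − L_i − e_i]^+ ≤ W^c + Σ_i [L_i + e_i − w_i]^+, then Σ_i v_i·[w_i − L_i]^+ ≤ W^c + Σ_i e_i + Σ_i [L_i − w_i]^+. -/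
open Finset

/-- Capacity-constraint transfer, (premise) implies (target) in the proof of Proposition 1. -/
theorem capacity_constraint_transfer {N : ℕ} (w L e : Fin N → ℝ)
    (he : ∀ i, 0 ≤ e i) (u : Fin N → ℝ) (hu : ∀ i, u i = 0 ∨ u i = 1)
    (Wc : ℝ) (v : Fin N → ℝ)
    (hv : ∀ i, v i = if (u i = 1 ∧ L i + e i < w i) ∨ (L i ≤ w i ∧ w i ≤ L i + e i)
      then (1 : ℝ) else 0)
    (hcap : ∑ i, u i * max (w i - L i - e i) 0 ≤ Wc + ∑ i, max (L i + e i - w i) 0) :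
    ∑ i, v i * max (w i - L i) 0 ≤ Wc + ∑ i, e i + ∑ i, max (L i - w i) 0 := by
  have pointwise : ∀ i, v i * max (w i - L i) 0 + max (L i + e i - w i) 0 ≤
      u i * max (w i - L i - e i) 0 + e i + max (L i - w i) 0 := by
    intro i
    have hei := he i
    rw [hv i]
    rcases lt_or_ge (L i + e i) (w i) with h | h
    · rw [max_eq_left (by linarith : 0 ≤ w i - L i),
        max_eq_right (by linarith : L i + e i - w i ≤ 0),
        max_eq_left (by linarith : 0 ≤ w i - L i - e i),
        max_eq_right (by linarith : L i - w i ≤ 0)]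
      rcases hu i with h0 | h1
      · simp [h0, h.not_ge, hei]
      · simp [h1, h]
    · rw [max_eq_left (by linarith : 0 ≤ L i + e i - w i),
        max_eq_right (by linarith : w i - L i - e i ≤ 0)]
      rcases le_or_gt (L i) (w i) with h' | h'
      · rw [if_pos (Or.inr ⟨h', h⟩), max_eq_left (by linarith : 0 ≤ w i - L i),
          max_eq_right (by linarith : L i - w i ≤ 0)]
        linarith
      · rw [max_eq_right (by linarith : w i - L i ≤ 0),
          max_eq_left (by linarith : 0 ≤ L i - w i)]
        linarith
  have total := Finset.sum_le_sum fun i (_ : i ∈ Finset.univ) => pointwise i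
  simp only [Finset.sum_add_distrib] at total
  linarith
end
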